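/- (2-approximation for the minimum k-way cut via a terminal set of the optimal partition.) Let G be a connected simple graph on a finite vertex set V with nonnegative edge weights w, let C* = {S_1, ..., S_k} be a k-partition of V whose cut-edge set E* has minimum total weight among all k-partitions of V, and let v_i ∈ S_i for each i. For each i, let E_i be an edge set of minimum total weight whose deletion separates {v_i} from {v_1,...,v_k} \ {v_i}. Then E = ⋃_{i=1}^k E_i pairwise separates v_1, ..., v_k and satisfies w(E) ≤ 2 · w(E*). -/

import Mathlib

open Finset

/-- The set of cut edges of a partition `S` of the vertices of `G`: edges of `G`
whose two endpoints lie in different parts. -/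
def partitionCutEdges {V : Type*} [Fintype V] [DecidableEq V]
    (G : SimpleGraph V) [DecidableRel G.Adj] {k : ℕ} (S : Fin k → Finset V) :
    Finset (Sym2 V) :=
  G.edgeFinset.filter (fun e => ∃ u x, e = s(u, x) ∧ ∃ i j, i ≠ j ∧ u ∈ S i ∧ x ∈ S j)

/-- The edges of `G` with exactly one endpoint in `A`. -/
def edgeBoundary {V : Type*} [Fintype V] [DecidableEq V]
    (G : SimpleGraph V) [DecidableRel G.Adj] (A : Finset V) : Finset (Sym2 V) :=
  G.edgeFinset.filter (fun e => ∃ u x, e = s(u, x) ∧ u ∈ A ∧ x ∉ A)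

theorem mem_edgeBoundary {V : Type*} [Fintype V] [DecidableEq V]
    {G : SimpleGraph V} [DecidableRel G.Adj] {A : Finset V} {e : Sym2 V} :
    e ∈ edgeBoundary G A ↔ e ∈ G.edgeSet ∧ ∃ u x, e = s(u, x) ∧ u ∈ A ∧ x ∉ A := by
  simp [edgeBoundary]

/-- After deleting the edge boundary of `A`, no vertex outside `A` is reachable from `A`. -/
theorem mem_of_reachable_deleteEdges_edgeBoundary {V : Type*} [Fintype V] [DecidableEq V]
    {G : SimpleGraph V} [DecidableRel G.Adj] {A : Finset V} {a b : V} (ha : a ∈ A)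
    (h : (G.deleteEdges ↑(edgeBoundary G A)).Reachable a b) : b ∈ A := by
  obtain ⟨p⟩ := h
  induction p with
  | nil => exact ha
  | @cons u x _ hadj _ ih =>
    refine ih ?_
    by_contra hx
    rw [SimpleGraph.deleteEdges_adj] at hadj
    exact hadj.2 (Finset.mem_coe.2 (mem_edgeBoundary.2 ⟨hadj.1, u, x, rfl, ha, hx⟩))

/-- Every edge boundary of a part consists of cut edges of the partition. -/
theorem edgeBoundary_subset_partitionCutEdges {V : Type*} [Fintype V] [DecidableEq V]
    {G : SimpleGraph V} [DecidableRel G.Adj] {k : ℕ} {S : Fin k → Finset V}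
    (hcover : ∀ u : V, ∃ i, u ∈ S i) (i : Fin k) :
    edgeBoundary G (S i) ⊆ partitionCutEdges G S := by
  intro e he
  obtain ⟨heG, u, x, rfl, hu, hx⟩ := mem_edgeBoundary.1 he
  obtain ⟨j, hj⟩ := hcover x
  refine Finset.mem_filter.2 ⟨SimpleGraph.mem_edgeFinset.2 heG, u, x, rfl, i, j, ?_, hu, hj⟩
  rintro rfl
  exact hx hj

/-- An edge lies in the edge boundary of at most two parts of a partition. -/
theorem card_filter_mem_edgeBoundary_le_two {V : Type*} [Fintype V] [DecidableEq V]
    {G : SimpleGraph V} [DecidableRel G.Adj] {k : ℕ} {S : Fin k → Finset V}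
    (hdisj : ∀ i j, i ≠ j → Disjoint (S i) (S j)) (hcover : ∀ u : V, ∃ i, u ∈ S i)
    (e : Sym2 V) : (Finset.univ.filter (fun i => e ∈ edgeBoundary G (S i))).card ≤ 2 := by
  induction e using Sym2.ind with
  | _ u x =>
    have part_unique {y : V} {i j : Fin k} (hi : y ∈ S i) (hj : y ∈ S j) : i = j := by
      by_contra hij
      exact Finset.disjoint_left.1 (hdisj i j hij) hi hj
    obtain ⟨a, ha⟩ := hcover u
    obtain ⟨b, hb⟩ := hcover x
    refine (Finset.card_le_card (t := {a, b}) fun i hi => ?_).trans Finset.card_le_two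
    obtain ⟨-, y, z, hyz, hy, -⟩ := mem_edgeBoundary.1 (Finset.mem_filter.1 hi).2
    rw [Finset.mem_insert, Finset.mem_singleton]
    rcases Sym2.eq_iff.1 hyz with ⟨rfl, rfl⟩ | ⟨rfl, rfl⟩
    · exact Or.inl (part_unique hy ha)
    · exact Or.inr (part_unique hy hb)

/-- The edge boundaries of the parts have total weight at most twice that of the cut edges. -/
theorem sum_sum_edgeBoundary_le {V : Type*} [Fintype V] [DecidableEq V]
    {G : SimpleGraph V} [DecidableRel G.Adj] {k : ℕ} {S : Fin k → Finset V}
    (hdisj : ∀ i j, i ≠ j → Disjoint (S i) (S j)) (hcover : ∀ u : V, ∃ i, u ∈ S i)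
    (w : Sym2 V → NNReal) :
    ∑ i, ∑ e ∈ edgeBoundary G (S i), w e ≤ 2 * ∑ e ∈ partitionCutEdges G S, w e := by
  rw [Finset.sum_comm' (t' := partitionCutEdges G S)
    (s' := fun e => Finset.univ.filter (fun i => e ∈ edgeBoundary G (S i)))
    (fun i e => ⟨fun h => ⟨by simpa using h.2, edgeBoundary_subset_partitionCutEdges hcover i h.2⟩,
      fun h => ⟨Finset.mem_univ i, (Finset.mem_filter.1 h.1).2⟩⟩), Finset.mul_sum]
  refine Finset.sum_le_sum fun e _ => ?_
  rw [Finset.sum_const, nsmul_eq_mul]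
  gcongr
  exact_mod_cast card_filter_mem_edgeBoundary_le_two hdisj hcover e

/-- The weight of a union is at most the sum of the weights. -/
theorem sum_biUnion_le_sum_sum {ι α : Type*} [DecidableEq α] (s : Finset ι)
    (t : ι → Finset α) (w : α → NNReal) :
    ∑ a ∈ s.biUnion t, w a ≤ ∑ i ∈ s, ∑ a ∈ t i, w a := by
  classical
  induction s using Finset.induction_on with
  | empty => simp
  | insert i s hi ih =>
    rw [Finset.biUnion_insert, Finset.sum_insert hi]
    refine le_trans ?_ (add_le_add_right ih _)
    rw [← Finset.sum_union_inter]
    exact le_self_add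

/-- 2-approximation for the minimum k-way cut via a terminal set of the optimal
partition: if `C* = {S_1,...,S_k}` is a minimum-weight k-way cut of the connected graph
`G`, `v_i ∈ S_i` for each `i`, and `E_i` is a minimum-weight edge set separating `{v_i}`
from `{v_1,...,v_k} \ {v_i}`, then `E = ⋃ E_i` pairwise separates `v_1, ..., v_k` and
`w(E) ≤ 2 · w(E*)`. -/
theorem two_approx_min_k_way_cut_via_terminals {V : Type*} [Fintype V] [DecidableEq V]
    (G : SimpleGraph V) [DecidableRel G.Adj] (hconn : G.Connected)
    (w : Sym2 V → NNReal) (hw : ∀ e : Sym2 V, e ∉ G.edgeSet → w e = 0)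
    (k : ℕ) (hk : 2 ≤ k)
    (S : Fin k → Finset V)
    (hne : ∀ i, (S i).Nonempty)
    (hdisj : ∀ i j, i ≠ j → Disjoint (S i) (S j))
    (hcover : ∀ u : V, ∃ i, u ∈ S i)
    (hmin : ∀ S' : Fin k → Finset V, (∀ i, (S' i).Nonempty) →
      (∀ i j, i ≠ j → Disjoint (S' i) (S' j)) → (∀ u : V, ∃ i, u ∈ S' i) →
      ∑ e ∈ partitionCutEdges G S, w e ≤ ∑ e ∈ partitionCutEdges G S', w e)
    (v : Fin k → V) (hv : ∀ i, v i ∈ S i)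
    (Ei : Fin k → Finset (Sym2 V))
    (hEsub : ∀ i, ↑(Ei i) ⊆ G.edgeSet)
    (hEsep : ∀ i, ∀ b : V, (∃ j, j ≠ i ∧ v j = b) →
      ¬ (G.deleteEdges ↑(Ei i)).Reachable (v i) b)
    (hEmin : ∀ i, ∀ F : Finset (Sym2 V), ↑F ⊆ G.edgeSet →
      (∀ b : V, (∃ j, j ≠ i ∧ v j = b) → ¬ (G.deleteEdges ↑F).Reachable (v i) b) →
      ∑ e ∈ Ei i, w e ≤ ∑ e ∈ F, w e) :
    (∀ i j, i ≠ j →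
      ¬ (G.deleteEdges ↑(Finset.univ.biUnion Ei)).Reachable (v i) (v j))
    ∧ ∑ e ∈ Finset.univ.biUnion Ei, w e
        ≤ 2 * ∑ e ∈ partitionCutEdges G S, w e := by
  refine ⟨fun i j hij h => hEsep i (v j) ⟨j, hij.symm, rfl⟩ (h.mono ?_), ?_⟩
  · exact SimpleGraph.deleteEdges_anti
      (Finset.coe_subset.2 (Finset.subset_biUnion_of_mem Ei (Finset.mem_univ i)))
  · refine (sum_biUnion_le_sum_sum Finset.univ Ei w).trans
      (le_trans (Finset.sum_le_sum fun i _ => ?_) (sum_sum_edgeBoundary_le hdisj hcover w))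
    refine hEmin i (edgeBoundary G (S i)) (fun e he => (mem_edgeBoundary.1 he).1) ?_
    rintro _ ⟨j, hji, rfl⟩ h
    exact Finset.disjoint_left.1 (hdisj j i hji) (hv j)
      (mem_of_reachable_deleteEdges_edgeBoundary (hv i) h)
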